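/- Let H ≤ F be a subgroup. Consider the space ∂F × ℤ with the σ-finite measure μ̃ = μ ⊗ (counting measure on ℤ) and the skew action of H given by h·(ω, k) = (h·ω, k + b_{h·ω}(h)) (geometrically, the action of H on the space of horospheres of F). Call a measurable set W̃ ⊆ ∂F × ℤ wandering if μ̃(hW̃ ∩ h′W̃) = 0 for all h ≠ h′ in H, and likewise for subsets of ∂F with the measure μ. Then: (i) the skew action of H on (∂F × ℤ, μ̃) is conservative (every wandering set is μ̃-null) if and only if the action of H on (∂F, μ) is conservative; and (ii) the skew action is completely dissipative (some wandering set has translates covering ∂F × ℤ up to a μ̃-null set) if and only if the action of H on (∂F, μ) is completely dissipative. -/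

import Mathlib

open MeasureTheory Filter Topology
open scoped ENNReal symmDiff

noncomputable section

/-- A letter of the alphabet `A ∪ A⁻¹` for the free group on `Fin m`. -/
abbrev Letter (m : ℕ) := Fin m × Bool

/-- The inverse letter. -/
def linv {m : ℕ} (x : Letter m) : Letter m := (x.1, !x.2)

/-- A sequence of letters is reduced if no letter is followed by its inverse. -/
def IsRedSeq {m : ℕ} (ω : ℕ → Letter m) : Prop := ∀ n, ω (n + 1) ≠ linv (ω n)

/-- The boundary `∂F`: infinite reduced words. -/
abbrev Boundary (m : ℕ) := {ω : ℕ → Letter m // IsRedSeq ω}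

/-- Word length of an element of the free group. -/
def wlen {m : ℕ} (g : FreeGroup (Fin m)) : ℕ := g.toWord.length

/-- The truncation `[ω]ₙ`: the group element given by the first `n` letters of `ω`. -/
def trunc {m : ℕ} (ω : Boundary m) (n : ℕ) : FreeGroup (Fin m) :=
  FreeGroup.mk (List.ofFn fun i : Fin n => ω.1 i)

/-- Cylinder set `C_g`. -/
def cylinder {m : ℕ} (g : FreeGroup (Fin m)) : Set (Boundary m) :=
  {ω | trunc ω (wlen g) = g}

/-- The Gromov product `(g|ω)`: length of the longest common initial segment of the
reduced word of `g` and `ω`. -/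
def gromov {m : ℕ} (g : FreeGroup (Fin m)) (ω : Boundary m) : ℕ :=
  sSup {k | ∀ i < k, g.toWord[i]? = some (ω.1 i)}

/-- The Busemann function `b_ω(g) = |g| - 2 (g|ω)`. -/
def busemann {m : ℕ} (g : FreeGroup (Fin m)) (ω : Boundary m) : ℤ :=
  (wlen g : ℤ) - 2 * (gromov g ω : ℤ)

/-- The number of letters cancelled in the free reduction of the concatenation
of a finite word `w` with an infinite reduced word `ω`. -/
def cancelLen {m : ℕ} (w : List (Letter m)) (ω : ℕ → Letter m) : ℕ :=
  sSup {k | k ≤ w.length ∧ ∀ i < k, w[w.length - 1 - i]? = some (linv (ω i))}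

/-- The sequence of letters of the free reduction of (reduced word of `g`) ++ `ω`. -/
def actSeq {m : ℕ} (g : FreeGroup (Fin m)) (ω : Boundary m) (n : ℕ) : Letter m :=
  if h : n < g.toWord.length - cancelLen g.toWord ω.1
  then g.toWord[n]'(by omega)
  else ω.1 (n - (g.toWord.length - cancelLen g.toWord ω.1) + cancelLen g.toWord ω.1)

theorem linv_linv {m : ℕ} (x : Letter m) : linv (linv x) = x := by
  simp [linv]

theorem toWord_chain {m : ℕ} (g : FreeGroup (Fin m)) {j : ℕ} (hj : j + 1 < g.toWord.length) :
    g.toWord[j + 1]'hj ≠ linv (g.toWord[j]'(by omega)) := by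
  intro h
  have hsplit : g.toWord = g.toWord.take j ++
      (g.toWord[j]'(by omega)) :: (g.toWord[j+1]'hj) :: g.toWord.drop (j + 2) := by
    conv_lhs => rw [← List.take_append_drop j g.toWord]
    congr 1
    rw [List.drop_eq_getElem_cons (by omega)]
    congr 1
    rw [List.drop_eq_getElem_cons (by omega)]
  rw [h] at hsplit
  have hred : FreeGroup.reduce g.toWord = g.toWord := FreeGroup.reduce_toWord g
  exact FreeGroup.reduce.not (by rw [hred, hsplit]; rfl)

theorem cancelLen_spec {m : ℕ} (w : List (Letter m)) (ω : ℕ → Letter m) :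
    cancelLen w ω ≤ w.length ∧
      ∀ i < cancelLen w ω, w[w.length - 1 - i]? = some (linv (ω i)) := by
  have : cancelLen w ω ∈
      {k | k ≤ w.length ∧ ∀ i < k, w[w.length - 1 - i]? = some (linv (ω i))} := by
    apply Nat.sSup_mem ⟨0, by simp⟩ ⟨w.length, fun x hx => hx.1⟩
  exact this

theorem cancelLen_max {m : ℕ} (w : List (Letter m)) (ω : ℕ → Letter m)
    (hlt : cancelLen w ω < w.length) :
    w[w.length - 1 - cancelLen w ω]? ≠ some (linv (ω (cancelLen w ω))) := by
  intro hcon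
  have hmem : cancelLen w ω + 1 ∈
      {k | k ≤ w.length ∧ ∀ i < k, w[w.length - 1 - i]? = some (linv (ω i))} := by
    refine ⟨hlt, fun i hi => ?_⟩
    rcases Nat.lt_succ_iff_lt_or_eq.mp hi with h | h
    · exact (cancelLen_spec w ω).2 i h
    · subst h; exact hcon
  have := le_csSup ⟨w.length, fun x hx => hx.1⟩ hmem
  simp only [cancelLen] at this ⊢
  omega

theorem isRedSeq_actSeq {m : ℕ} (g : FreeGroup (Fin m)) (ω : Boundary m) :
    IsRedSeq (actSeq g ω) := by
  intro n
  obtain ⟨hkle, hcan⟩ := cancelLen_spec g.toWord ω.1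
  by_cases h1 : n + 1 < g.toWord.length - cancelLen g.toWord ω.1
  · have h0 : n < g.toWord.length - cancelLen g.toWord ω.1 := by omega
    rw [show actSeq g ω (n + 1) = g.toWord[n + 1]'(by omega) from dif_pos h1,
        show actSeq g ω n = g.toWord[n]'(by omega) from dif_pos h0]
    exact toWord_chain g (by omega)
  · by_cases h0 : n < g.toWord.length - cancelLen g.toWord ω.1
    · have hklt : cancelLen g.toWord ω.1 < g.toWord.length := by omega
      have hidx : n = g.toWord.length - 1 - cancelLen g.toWord ω.1 := by omega
      have e0 : actSeq g ω n = g.toWord[n]'(by omega) := dif_pos h0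
      have e1 : actSeq g ω (n + 1) =
          ω.1 (n + 1 - (g.toWord.length - cancelLen g.toWord ω.1) +
            cancelLen g.toWord ω.1) := dif_neg h1
      have harg : n + 1 - (g.toWord.length - cancelLen g.toWord ω.1) +
          cancelLen g.toWord ω.1 = cancelLen g.toWord ω.1 := by omega
      rw [harg] at e1
      rw [e0, e1]
      intro hcon
      apply cancelLen_max g.toWord ω.1 hklt
      subst hidx
      rw [List.getElem?_eq_getElem (by omega), hcon, linv_linv]
    · have e0 : actSeq g ω n =
          ω.1 (n - (g.toWord.length - cancelLen g.toWord ω.1) +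
            cancelLen g.toWord ω.1) := dif_neg h0
      have e1 : actSeq g ω (n + 1) =
          ω.1 (n + 1 - (g.toWord.length - cancelLen g.toWord ω.1) +
            cancelLen g.toWord ω.1) := dif_neg (by omega)
      have harg : n + 1 - (g.toWord.length - cancelLen g.toWord ω.1) +
          cancelLen g.toWord ω.1 =
          (n - (g.toWord.length - cancelLen g.toWord ω.1) + cancelLen g.toWord ω.1) + 1 := by
        omega
      rw [e0, e1, harg]
      exact ω.2 _

/-- The boundary action of `F` on `∂F`: `g · ω` is the free reduction of the
concatenation of the reduced word of `g` with `ω`. -/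
def bact {m : ℕ} (g : FreeGroup (Fin m)) (ω : Boundary m) : Boundary m :=
  ⟨actSeq g ω, isRedSeq_actSeq g ω⟩


/-- A nonsingular action `T` of a group on a measure space, together with an additive
integer cocycle `c` such that `T g` at least doubles the measure of sets on which `c g` is
positive. -/
structure IsExpandingCocycle {X Γ : Type*} [MeasurableSpace X] [Group Γ] (μ : Measure X)
    (T : Γ → X → X) (c : Γ → X → ℤ) : Prop where
  one_act : ∀ x, T 1 x = x
  mul_act : ∀ g h x, T (g * h) x = T g (T h x)
  cocycle : ∀ g h x, c (g * h) x = c g (T h x) + c h x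
  measurable_act : ∀ g, Measurable (T g)
  measurable_cocycle : ∀ g, Measurable (c g)
  null_image : ∀ g A, MeasurableSet A → μ A = 0 → μ (T g '' A) = 0
  two_mul_le : ∀ g A, MeasurableSet A → (∀ x ∈ A, 0 < c g x) → 2 * μ A ≤ μ (T g '' A)

/-- The product of a wandering set with `ℤ` is wandering for the skew action. -/
theorem skew_wandering {X Γ : Type*} [MeasurableSpace X] {μ : Measure X} [SFinite μ]
    {T : Γ → X → X} {c : Γ → X → ℤ} {S : Γ → X × ℤ → X × ℤ}
    (hS : ∀ g p, S g p = (T g p.1, p.2 + c g p.1)) {W : Set X} {g h : Γ}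
    (hw : μ (T g '' W ∩ T h '' W) = 0) :
    (μ.prod Measure.count) (S g '' (W ×ˢ Set.univ) ∩ S h '' (W ×ˢ Set.univ)) = 0 := by
  have hsub : S g '' (W ×ˢ Set.univ) ∩ S h '' (W ×ˢ Set.univ) ⊆
      (T g '' W ∩ T h '' W) ×ˢ Set.univ := by
    rintro _ ⟨⟨p, hp, rfl⟩, ⟨q, hq, hpq⟩⟩
    rw [hS, hS, Prod.mk.injEq] at hpq
    rw [hS]
    exact ⟨⟨⟨_, hp.1, rfl⟩, ⟨_, hq.1, hpq.1⟩⟩, Set.mem_univ _⟩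
  refine measure_mono_null hsub ?_
  rw [Measure.prod_prod, hw, zero_mul]

namespace IsExpandingCocycle

variable {X Γ : Type*} [MeasurableSpace X] [Group Γ] {μ : Measure X}
  {T : Γ → X → X} {c : Γ → X → ℤ}

theorem inv_act (hT : IsExpandingCocycle μ T c) (g : Γ) (x : X) : T g⁻¹ (T g x) = x := by
  rw [← hT.mul_act, inv_mul_cancel, hT.one_act]

theorem act_inv (hT : IsExpandingCocycle μ T c) (g : Γ) (x : X) : T g (T g⁻¹ x) = x := by
  rw [← hT.mul_act, mul_inv_cancel, hT.one_act]

theorem cocycle_one (hT : IsExpandingCocycle μ T c) (x : X) : c 1 x = 0 := by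
  have h := hT.cocycle 1 1 x
  rw [mul_one, hT.one_act] at h
  omega

theorem cocycle_inv (hT : IsExpandingCocycle μ T c) (g : Γ) (x : X) :
    c g⁻¹ (T g x) = - c g x := by
  have h := hT.cocycle g⁻¹ g x
  rw [inv_mul_cancel, hT.cocycle_one] at h
  omega

theorem measurableSet_image (hT : IsExpandingCocycle μ T c) (g : Γ) {A : Set X}
    (hA : MeasurableSet A) : MeasurableSet (T g '' A) := by
  have : T g '' A = T g⁻¹ ⁻¹' A := by
    ext x
    constructor
    · rintro ⟨y, hy, rfl⟩
      simpa [hT.inv_act] using hy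
    · intro hx
      exact ⟨_, hx, hT.act_inv g x⟩
  rw [this]
  exact hT.measurable_act _ hA

/-- A set in which no two distinct returns have the same height is null as soon as every
point of it has a return of positive height. -/
theorem measure_eq_zero_of_forall_exists_pos [Countable Γ] [IsFiniteMeasure μ]
    (hT : IsExpandingCocycle μ T c) {W : Set X} (hW : MeasurableSet W)
    (hw : ∀ g, g ≠ 1 → μ {x | x ∈ W ∧ T g x ∈ W ∧ c g x = 0} = 0)
    (hup : ∀ x ∈ W, ∃ g, T g x ∈ W ∧ 0 < c g x) : μ W = 0 := by
  have mW : ∀ g, MeasurableSet {x | T g x ∈ W} := fun g => hT.measurable_act g hW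
  have mpos : ∀ g, MeasurableSet {x | 0 < c g x} := fun g =>
    hT.measurable_cocycle g (measurableSet_Ioi (a := (0 : ℤ)))
  let A : Γ → Set X := fun g => {x | x ∈ W ∧ T g x ∈ W ∧ 0 < c g x ∧
    ∀ g', T g' x ∈ W → 0 < c g' x → c g x ≤ c g' x}
  have hAm : ∀ g, MeasurableSet (A g) := by
    intro g
    have hmin : MeasurableSet
        {x | ∀ g', T g' x ∈ W → 0 < c g' x → c g x ≤ c g' x} := by
      rw [Set.ofPred_forall]
      exact MeasurableSet.iInter fun g' => (mW g').imp ((mpos g').imp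
        (measurableSet_le (hT.measurable_cocycle g) (hT.measurable_cocycle g')))
    exact hW.inter ((mW g).inter ((mpos g).inter hmin))
  have hcov : W ⊆ ⋃ g, A g := by
    intro x hx
    have hne : ∃ n : ℕ, ∃ g, T g x ∈ W ∧ 0 < c g x ∧ c g x = n := by
      obtain ⟨g, h1, h2⟩ := hup x hx
      exact ⟨(c g x).toNat, g, h1, h2, by omega⟩
    classical
    obtain ⟨g, h1, h2, h3⟩ := Nat.find_spec hne
    refine Set.mem_iUnion.2 ⟨g, hx, h1, h2, fun g' h1' h2' => ?_⟩
    have := Nat.find_min' hne (m := (c g' x).toNat) ⟨g', h1', h2', by omega⟩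
    omega
  have hdisj : Pairwise (Function.onFun (AEDisjoint μ) fun g => T g '' A g) := by
    intro g h hgh
    have hsub : T g '' A g ∩ T h '' A h ⊆
        T g '' {x | x ∈ W ∧ T (h⁻¹ * g) x ∈ W ∧ c (h⁻¹ * g) x = 0} := by
      rintro _ ⟨⟨x, hx, rfl⟩, ⟨y, hy, hxy⟩⟩
      have hyx : T (h⁻¹ * g) x = y := by rw [hT.mul_act, ← hxy, hT.inv_act]
      have hxy' : T (g⁻¹ * h) y = x := by rw [hT.mul_act, hxy, hT.inv_act]
      have e1 : c g x = c h y + c (h⁻¹ * g) x := by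
        have := hT.cocycle h (h⁻¹ * g) x
        rwa [mul_inv_cancel_left, hyx] at this
      have e2 : c h y = c g x + c (g⁻¹ * h) y := by
        have := hT.cocycle g (g⁻¹ * h) y
        rwa [mul_inv_cancel_left, hxy'] at this
      refine ⟨x, ⟨hx.1, hyx ▸ hy.1, ?_⟩, rfl⟩
      have p1 := hx.2.2.1
      have p2 := hy.2.2.1
      have m1 := hx.2.2.2 (h⁻¹ * g) (hyx ▸ hy.1)
      have m2 := hy.2.2.2 (g⁻¹ * h) (hxy' ▸ hx.1)
      by_contra hne
      rcases lt_or_gt_of_ne hne with hlt | hlt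
      · have := m2 (by omega)
        omega
      · have := m1 hlt
        omega
    refine measure_mono_null hsub (hT.null_image g _ ?_ (hw _ ?_))
    · exact hW.inter ((hT.measurable_act _ hW).inter
        (hT.measurable_cocycle _ (measurableSet_singleton (0 : ℤ))))
    · intro h1
      exact hgh (inv_mul_eq_one.1 h1).symm
  have hle : 2 * μ W ≤ μ W := calc
    2 * μ W ≤ 2 * ∑' g, μ (A g) := by
      gcongr
      exact (measure_mono hcov).trans (measure_iUnion_le _)
    _ = ∑' g, 2 * μ (A g) := ENNReal.tsum_mul_left.symm
    _ ≤ ∑' g, μ (T g '' A g) :=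
      ENNReal.tsum_le_tsum fun g => hT.two_mul_le g _ (hAm g) fun x hx => hx.2.2.1
    _ = μ (⋃ g, T g '' A g) := (measure_iUnion₀ hdisj
      fun g => (hT.measurableSet_image g (hAm g)).nullMeasurableSet).symm
    _ ≤ μ W := by
      refine measure_mono (Set.iUnion_subset fun g => ?_)
      rintro _ ⟨x, hx, rfl⟩
      exact hx.2.1
  by_contra hne
  rw [two_mul] at hle
  have := ENNReal.lt_add_right (measure_ne_top μ W) hne
  exact absurd hle (not_le.2 this)

/-- If no two distinct returns to `W` have the same height, then the points of `W` without
returns of positive height form a set that is wandering for the action and whose translates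
cover almost all of `W`. -/
theorem exists_wandering_subset [Countable Γ] [IsFiniteMeasure μ]
    (hT : IsExpandingCocycle μ T c) {W : Set X} (hW : MeasurableSet W)
    (hw : ∀ g, g ≠ 1 → μ {x | x ∈ W ∧ T g x ∈ W ∧ c g x = 0} = 0) :
    ∃ D, MeasurableSet D ∧ (∀ g, g ≠ 1 → μ {x | x ∈ D ∧ T g x ∈ D} = 0) ∧
      μ (W \ ⋃ g, T g '' D) = 0 := by
  let D : Set X := {x | x ∈ W ∧ ∀ g, T g x ∈ W → c g x ≤ 0}
  have hD : MeasurableSet D := by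
    have hmax : MeasurableSet {x | ∀ g, T g x ∈ W → c g x ≤ 0} := by
      rw [Set.ofPred_forall]
      exact MeasurableSet.iInter fun g => MeasurableSet.imp (hT.measurable_act g hW)
        (hT.measurable_cocycle g (measurableSet_Iic (a := (0 : ℤ))))
    exact hW.inter hmax
  refine ⟨D, hD, fun g hg => measure_mono_null ?_ (hw g hg), ?_⟩
  · rintro x ⟨hx, hgx⟩
    have h1 := hx.2 g hgx.1
    have h2 := hgx.2 g⁻¹ (by rw [hT.inv_act]; exact hx.1)
    rw [hT.cocycle_inv] at h2
    exact ⟨hx.1, hgx.1, by omega⟩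
  · refine hT.measure_eq_zero_of_forall_exists_pos
      (hW.diff (MeasurableSet.iUnion fun g => hT.measurableSet_image g hD))
      (fun g hg => measure_mono_null ?_ (hw g hg)) ?_
    · rintro x ⟨h1, h2, h3⟩
      exact ⟨h1.1, h2.1, h3⟩
    · rintro x ⟨hx, hxD⟩
      by_contra! hcon
      refine hxD (Set.mem_iUnion.2 ⟨1, x, ⟨hx, fun g hg => hcon g ⟨hg, fun hgD => hxD ?_⟩⟩,
        hT.one_act x⟩)
      obtain ⟨h, y, hy, hyx⟩ := Set.mem_iUnion.1 hgD
      exact Set.mem_iUnion.2 ⟨g⁻¹ * h, y, hy, by rw [hT.mul_act, hyx, hT.inv_act]⟩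

theorem wandering_of_forall_ne_one (hT : IsExpandingCocycle μ T c) {D : Set X}
    (hD : MeasurableSet D) (hw : ∀ g, g ≠ 1 → μ {x | x ∈ D ∧ T g x ∈ D} = 0)
    {g h : Γ} (hgh : g ≠ h) : μ (T g '' D ∩ T h '' D) = 0 := by
  have hsub : T g '' D ∩ T h '' D ⊆ T g '' {x | x ∈ D ∧ T (h⁻¹ * g) x ∈ D} := by
    rintro _ ⟨⟨x, hx, rfl⟩, ⟨y, hy, hxy⟩⟩
    refine ⟨x, ⟨hx, ?_⟩, rfl⟩
    rwa [hT.mul_act, ← hxy, hT.inv_act]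
  refine measure_mono_null hsub (hT.null_image g _ (hD.inter (hT.measurable_act _ hD)) (hw _ ?_))
  intro h1
  exact hgh (inv_mul_eq_one.1 h1).symm

theorem level_wandering (hT : IsExpandingCocycle μ T c) [SFinite μ] {W : Set (X × ℤ)}
    {S : Γ → X × ℤ → X × ℤ} (hS : ∀ g p, S g p = (T g p.1, p.2 + c g p.1))
    (hw : ∀ g h, g ≠ h → (μ.prod Measure.count) (S g '' W ∩ S h '' W) = 0)
    (k : ℤ) (g : Γ) (hg : g ≠ 1) :
    μ {x | x ∈ {x | (x, k) ∈ W} ∧ T g x ∈ {x | (x, k) ∈ W} ∧ c g x = 0} = 0 := by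
  set B := {x | x ∈ {x | (x, k) ∈ W} ∧ T g x ∈ {x | (x, k) ∈ W} ∧ c g x = 0}
  have hsub : B ×ˢ {k} ⊆ S 1 '' W ∩ S g⁻¹ '' W := by
    rintro ⟨x, j⟩ ⟨⟨h1, h2, h3⟩, rfl⟩
    refine ⟨⟨(x, j), h1, ?_⟩, ⟨(T g x, j), h2, ?_⟩⟩
    · rw [hS, hT.one_act, hT.cocycle_one, add_zero]
    · rw [hS, hT.inv_act, hT.cocycle_inv, h3, neg_zero, add_zero]
  have h0 := measure_mono_null hsub (hw 1 g⁻¹ (by simpa [eq_comm] using hg))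
  rw [Measure.prod_prod, Measure.count_singleton, mul_one] at h0
  exact h0

theorem conservative_skew_iff [Countable Γ] [IsFiniteMeasure μ] (hT : IsExpandingCocycle μ T c)
    {S : Γ → X × ℤ → X × ℤ} (hS : ∀ g p, S g p = (T g p.1, p.2 + c g p.1)) :
    (∀ W, MeasurableSet W →
        (∀ g h, g ≠ h → (μ.prod Measure.count) (S g '' W ∩ S h '' W) = 0) →
        (μ.prod Measure.count) W = 0) ↔
      (∀ W, MeasurableSet W → (∀ g h, g ≠ h → μ (T g '' W ∩ T h '' W) = 0) → μ W = 0) := by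
  constructor
  · intro hcons W hW hw
    have h0 := hcons (W ×ˢ Set.univ) (hW.prod MeasurableSet.univ)
      fun g h hgh => skew_wandering hS (hw g h hgh)
    rw [Measure.prod_prod, mul_eq_zero] at h0
    refine h0.resolve_right ?_
    simp
  · intro hcons W hW hw
    have hlevel : ∀ k : ℤ, μ {x | (x, k) ∈ W} = 0 := by
      intro k
      have hWk : MeasurableSet {x | (x, k) ∈ W} := measurable_prodMk_right hW
      obtain ⟨D, hD, hDw, hDc⟩ := hT.exists_wandering_subset hWk
        (hT.level_wandering hS hw k)
      have hD0 := hcons D hD fun g h hgh => hT.wandering_of_forall_ne_one hD hDw hgh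
      have hU : μ (⋃ g, T g '' D) = 0 :=
        measure_iUnion_null fun g => hT.null_image g D hD hD0
      refine measure_mono_null (t := ({x | (x, k) ∈ W} \ ⋃ g, T g '' D) ∪ ⋃ g, T g '' D) ?_
        (measure_union_null hDc hU)
      intro x hx
      by_cases h : x ∈ ⋃ g, T g '' D
      · exact Or.inr h
      · exact Or.inl ⟨hx, h⟩
    refine measure_mono_null (t := ⋃ k : ℤ, {x | (x, k) ∈ W} ×ˢ {k}) ?_
      (measure_iUnion_null fun k => ?_)
    · rintro ⟨x, k⟩ h
      exact Set.mem_iUnion.2 ⟨k, h, rfl⟩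
    · rw [Measure.prod_prod, hlevel, zero_mul]

/-- Countably many wandering sets can be merged into one wandering set with the same
saturation. -/
theorem exists_wandering_iUnion [Countable Γ] (hT : IsExpandingCocycle μ T c) {D : ℕ → Set X}
    (hD : ∀ n, MeasurableSet (D n))
    (hw : ∀ n g, g ≠ 1 → μ {x | x ∈ D n ∧ T g x ∈ D n} = 0) :
    ∃ V, MeasurableSet V ∧ (∀ g, g ≠ 1 → μ {x | x ∈ V ∧ T g x ∈ V} = 0) ∧
      (⋃ n, ⋃ g, T g '' D n) ⊆ ⋃ g, T g '' V := by
  let V : ℕ → Set X := fun n => D n \ ⋃ j : ℕ, ⋃ _ : j < n, ⋃ g, T g '' D j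
  have hV : ∀ n, MeasurableSet (V n) := fun n =>
    (hD n).diff (MeasurableSet.iUnion fun j => MeasurableSet.iUnion fun _ =>
      MeasurableSet.iUnion fun g => hT.measurableSet_image g (hD j))
  have hlt : ∀ {i j : ℕ} {g : Γ} {x : X}, x ∈ V i → T g x ∈ V j → ¬ j < i := by
    intro i j g x hx hgx hji
    refine hx.2 ?_
    simp only [Set.mem_iUnion]
    exact ⟨j, hji, g⁻¹, T g x, hgx.1, hT.inv_act g x⟩
  refine ⟨⋃ n, V n, MeasurableSet.iUnion hV, fun g hg => ?_, ?_⟩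
  · refine measure_mono_null (t := ⋃ n, {x | x ∈ D n ∧ T g x ∈ D n}) ?_
      (measure_iUnion_null fun n => hw n g hg)
    rintro x ⟨hx, hgx⟩
    obtain ⟨i, hi⟩ := Set.mem_iUnion.1 hx
    obtain ⟨j, hj⟩ := Set.mem_iUnion.1 hgx
    have h1 := hlt hi hj
    have h2 := hlt (g := g⁻¹) hj (by rw [hT.inv_act]; exact hi)
    obtain rfl : i = j := by omega
    exact Set.mem_iUnion.2 ⟨i, hi.1, hj.1⟩
  · intro x hx
    have hne : ∃ n, ∃ g, x ∈ T g '' D n := by simpa only [Set.mem_iUnion] using hx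
    classical
    obtain ⟨g, y, hy, rfl⟩ := Nat.find_spec hne
    refine Set.mem_iUnion.2 ⟨g, y, Set.mem_iUnion.2 ⟨Nat.find hne, hy, ?_⟩, rfl⟩
    simp only [Set.mem_iUnion, not_exists]
    rintro j hj h ⟨z, hz, rfl⟩
    exact Nat.find_min hne hj ⟨g * h, z, hz, hT.mul_act g h z⟩

theorem dissipative_skew_iff [Countable Γ] [IsFiniteMeasure μ] (hT : IsExpandingCocycle μ T c)
    {S : Γ → X × ℤ → X × ℤ} (hS : ∀ g p, S g p = (T g p.1, p.2 + c g p.1)) :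
    (∃ W, MeasurableSet W ∧
        (∀ g h, g ≠ h → (μ.prod Measure.count) (S g '' W ∩ S h '' W) = 0) ∧
        (μ.prod Measure.count) (Set.univ \ ⋃ g, S g '' W) = 0) ↔
      (∃ W, MeasurableSet W ∧ (∀ g h, g ≠ h → μ (T g '' W ∩ T h '' W) = 0) ∧
        μ (Set.univ \ ⋃ g, T g '' W) = 0) := by
  constructor
  · rintro ⟨W, hW, hw, hcov⟩
    have hWk : ∀ k : ℤ, MeasurableSet {x | (x, k) ∈ W} := fun k => measurable_prodMk_right hW
    choose D hD hDw hDc using fun k =>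
      hT.exists_wandering_subset (hWk k) (hT.level_wandering hS hw k)
    obtain ⟨e, he⟩ := exists_surjective_nat ℤ
    obtain ⟨V, hV, hVw, hVc⟩ := hT.exists_wandering_iUnion (fun n => hD (e n))
      fun n => hDw (e n)
    refine ⟨V, hV, fun g h hgh => hT.wandering_of_forall_ne_one hV hVw hgh, ?_⟩
    have hbad : μ (⋃ k : ℤ, ⋃ g, T g '' ({x | (x, k) ∈ W} \ ⋃ g, T g '' D k)) = 0 :=
      measure_iUnion_null fun k => measure_iUnion_null fun g => hT.null_image g _
        ((hWk k).diff (MeasurableSet.iUnion fun g => hT.measurableSet_image g (hD k))) (hDc k)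
    have hzero : μ {x | (x, (0 : ℤ)) ∉ ⋃ g, S g '' W} = 0 := by
      have hsub : {x | (x, (0 : ℤ)) ∉ ⋃ g, S g '' W} ×ˢ {(0 : ℤ)} ⊆
          Set.univ \ ⋃ g, S g '' W := by
        rintro ⟨x, j⟩ ⟨hx, rfl⟩
        exact ⟨Set.mem_univ _, hx⟩
      have h0 := measure_mono_null hsub hcov
      rwa [Measure.prod_prod, Measure.count_singleton, mul_one] at h0
    refine measure_mono_null ?_ (measure_union_null hzero hbad)
    rintro x ⟨-, hx⟩
    by_contra hcon
    simp only [Set.mem_union, not_or, Set.mem_ofPred_eq, not_not] at hcon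
    obtain ⟨h1, h2⟩ := hcon
    obtain ⟨g, ⟨y, k⟩, hy, hyx⟩ := Set.mem_iUnion.1 h1
    rw [hS, Prod.mk.injEq] at hyx
    by_cases hyD : y ∈ ⋃ g, T g '' D k
    · obtain ⟨h, z, hz, rfl⟩ := Set.mem_iUnion.1 hyD
      obtain ⟨n, rfl⟩ := he k
      refine hx (hVc (Set.mem_iUnion.2 ⟨n, Set.mem_iUnion.2 ⟨g * h, z, hz, ?_⟩⟩))
      rw [hT.mul_act, hyx.1]
    · exact h2 (Set.mem_iUnion.2 ⟨k, Set.mem_iUnion.2 ⟨g, y, ⟨hy, hyD⟩, hyx.1⟩⟩)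
  · rintro ⟨W, hW, hw, hcov⟩
    refine ⟨W ×ˢ Set.univ, hW.prod MeasurableSet.univ, fun g h hgh => ?_, ?_⟩
    · exact skew_wandering hS (hw g h hgh)
    · have hsub : Set.univ \ ⋃ g, S g '' (W ×ˢ Set.univ) ⊆
          (Set.univ \ ⋃ g, T g '' W) ×ˢ (Set.univ : Set ℤ) := by
        rintro ⟨x, k⟩ ⟨-, hx⟩
        refine ⟨⟨Set.mem_univ _, fun hxW => hx ?_⟩, Set.mem_univ _⟩
        obtain ⟨g, y, hy, rfl⟩ := Set.mem_iUnion.1 hxW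
        refine Set.mem_iUnion.2 ⟨g, (y, k - c g y), ⟨hy, Set.mem_univ _⟩, ?_⟩
        rw [hS, sub_add_cancel]
      refine measure_mono_null hsub ?_
      rw [Measure.prod_prod, hcov, zero_mul]

end IsExpandingCocycle

theorem cancelLen_eq {m : ℕ} {w : List (Letter m)} {ω : ℕ → Letter m} {k : ℕ}
    (hk : k ≤ w.length) (hcan : ∀ i < k, w[w.length - 1 - i]? = some (linv (ω i)))
    (hmax : k < w.length → w[w.length - 1 - k]? ≠ some (linv (ω k))) :
    cancelLen w ω = k := by
  obtain ⟨hle, hspec⟩ := cancelLen_spec w ω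
  rcases lt_trichotomy (cancelLen w ω) k with h | h | h
  · exact absurd (hcan _ h) (cancelLen_max w ω (by omega))
  · exact h
  · exact absurd (hspec _ h) (hmax (by omega))

theorem cancelLen_cons {m : ℕ} (a : Letter m) (w : List (Letter m)) (ω : ℕ → Letter m) :
    cancelLen (a :: w) ω =
      if cancelLen w ω = w.length ∧ ω w.length = linv a then w.length + 1
      else cancelLen w ω := by
  obtain ⟨hle, hspec⟩ := cancelLen_spec w ω
  have hcons : ∀ i < w.length, (a :: w)[(a :: w).length - 1 - i]? = w[w.length - 1 - i]? := by
    intro i hi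
    rw [List.length_cons, show w.length + 1 - 1 - i = (w.length - 1 - i) + 1 by omega,
      List.getElem?_cons_succ]
  have hlast : (a :: w)[(a :: w).length - 1 - w.length]? = some a := by simp
  split_ifs with h
  · refine cancelLen_eq (by simp) (fun i hi => ?_) (by simp)
    rcases Nat.lt_succ_iff_lt_or_eq.1 hi with hi | rfl
    · rw [hcons i hi]
      exact hspec i (by omega)
    · rw [hlast, h.2, linv_linv]
  · refine cancelLen_eq (by simp; omega) (fun i hi => ?_) (fun hlt => ?_)
    · rw [hcons i (by omega)]
      exact hspec i hi
    · rcases Nat.lt_or_ge (cancelLen w ω) w.length with h1 | h1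
      · rw [hcons _ h1]
        exact cancelLen_max w ω h1
      · have h2 : cancelLen w ω = w.length := by omega
        rw [h2, hlast]
        intro h3
        refine h ⟨h2, ?_⟩
        rw [Option.some.inj h3, linv_linv]

/-- Deletion of the first letter. -/
def shift {m : ℕ} (ω : Boundary m) : Boundary m :=
  ⟨fun n => ω.1 (n + 1), fun n => ω.2 (n + 1)⟩

/-- Left multiplication of a boundary point by a letter. -/
def letterAct {m : ℕ} (a : Letter m) (ω : Boundary m) : Boundary m :=
  ⟨fun n => if ω.1 0 = linv a then ω.1 (n + 1) else if n = 0 then a else ω.1 (n - 1), by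
    intro n
    by_cases h : ω.1 0 = linv a
    · simp only [h, if_true]
      exact ω.2 (n + 1)
    · cases n with
      | zero => simp [h]
      | succ n => simpa [h] using ω.2 n⟩

/-- The value of the Busemann cocycle on a letter. -/
def letterCocycle {m : ℕ} (a : Letter m) (ω : Boundary m) : ℤ :=
  if ω.1 0 = linv a then 1 else -1

/-- The skew action of a letter. -/
def letterSkew {m : ℕ} (a : Letter m) (p : Boundary m × ℤ) : Boundary m × ℤ :=
  (letterAct a p.1, p.2 + letterCocycle a p.1)

theorem linv_ne {m : ℕ} (a : Letter m) : linv a ≠ a := by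
  intro h
  have := congrArg Prod.snd h
  simp [linv] at this

theorem letterAct_of_eq {m : ℕ} {a : Letter m} {ω : Boundary m} (h : ω.1 0 = linv a) :
    letterAct a ω = shift ω := by
  ext1
  funext n
  simp [letterAct, shift, h]

theorem letterAct_zero {m : ℕ} {a : Letter m} {ω : Boundary m} (h : ω.1 0 ≠ linv a) :
    (letterAct a ω).1 0 = a := by
  simp [letterAct, h]

theorem letterAct_succ {m : ℕ} {a : Letter m} {ω : Boundary m} (h : ω.1 0 ≠ linv a) (n : ℕ) :
    (letterAct a ω).1 (n + 1) = ω.1 n := by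
  simp [letterAct, h]

theorem shift_letterAct {m : ℕ} {a : Letter m} {ω : Boundary m} (h : ω.1 0 ≠ linv a) :
    shift (letterAct a ω) = ω := by
  ext1
  funext n
  exact letterAct_succ h n

theorem letterAct_shift {m : ℕ} {a : Letter m} {ω : Boundary m} (h : ω.1 0 = a) :
    letterAct a (shift ω) = ω := by
  have h1 : (shift ω).1 0 ≠ linv a := by
    rw [← h]
    exact ω.2 0
  ext1
  funext n
  cases n with
  | zero => rw [letterAct_zero h1, h]
  | succ n => rw [letterAct_succ h1]; rfl

theorem letterSkew_linv {m : ℕ} (a : Letter m) (p : Boundary m × ℤ) :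
    letterSkew (linv a) (letterSkew a p) = p := by
  obtain ⟨ω, k⟩ := p
  by_cases h : ω.1 0 = linv a
  · have h1 : (shift ω).1 0 ≠ linv (linv a) := by
      rw [← h]
      exact ω.2 0
    simp [letterSkew, letterCocycle, letterAct_of_eq h, letterAct_shift h, h, h1]
  · have h1 : (letterAct a ω).1 0 = linv (linv a) := by rw [letterAct_zero h, linv_linv]
    simp [letterSkew, letterCocycle, letterAct_of_eq h1, shift_letterAct h, h, h1]

/-- The skew action of the free group, generated by the skew action of letters. -/
def skewPerm (m : ℕ) : FreeGroup (Fin m) →* Equiv.Perm (Boundary m × ℤ) :=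
  FreeGroup.lift fun i =>
    { toFun := letterSkew (i, true)
      invFun := letterSkew (i, false)
      left_inv := letterSkew_linv (i, true)
      right_inv := letterSkew_linv (i, false) }

theorem skewPerm_mk {m : ℕ} (w : List (Letter m)) (p : Boundary m × ℤ) :
    skewPerm m (FreeGroup.mk w) p = w.foldr letterSkew p := by
  rw [skewPerm, FreeGroup.lift_mk]
  induction w with
  | nil => rfl
  | cons a w ih =>
    rw [List.map_cons, List.prod_cons, Equiv.Perm.mul_apply, ih, List.foldr_cons]
    obtain ⟨i, _ | _⟩ := a <;> rfl

theorem foldr_letterSkew {m : ℕ} (w : List (Letter m)) (hw : FreeGroup.IsReduced w)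
    (ω : Boundary m) (k : ℤ) :
    (w.foldr letterSkew (ω, k)).2 = k + (2 * cancelLen w ω.1 - w.length) ∧
      (∀ n < w.length - cancelLen w ω.1,
        w[n]? = some ((w.foldr letterSkew (ω, k)).1.1 n)) ∧
      ∀ n, (w.foldr letterSkew (ω, k)).1.1 (w.length - cancelLen w ω.1 + n) =
        ω.1 (cancelLen w ω.1 + n) := by
  induction w with
  | nil =>
    have h : cancelLen [] ω.1 = 0 := cancelLen_eq le_rfl (by simp) (by simp)
    simp [h]
  | cons a w ih =>
    have hred : FreeGroup.IsReduced w := List.IsChain.tail hw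
    obtain ⟨ih1, ih2, ih3⟩ := ih hred
    obtain ⟨hle, -⟩ := cancelLen_spec w ω.1
    rw [List.foldr_cons, cancelLen_cons]
    set ξ := w.foldr letterSkew (ω, k)
    by_cases h0 : cancelLen w ω.1 = w.length
    · rw [h0] at ih1 ih3
      simp only [Nat.sub_self, zero_add] at ih3
      by_cases h1 : ω.1 w.length = linv a
      · have h2 : ξ.1.1 0 = linv a := by rw [ih3 0, add_zero, h1]
        rw [if_pos ⟨h0, h1⟩]
        refine ⟨?_, ?_, ?_⟩
        · simp only [letterSkew, letterCocycle, h2, if_true, ih1, List.length_cons]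
          push_cast
          ring
        · simp
        · intro n
          simp only [letterSkew, letterAct_of_eq h2, shift, List.length_cons, Nat.sub_self,
            zero_add, ih3, add_assoc, add_comm 1 n]
      · have h2 : ξ.1.1 0 ≠ linv a := by rwa [ih3 0, add_zero]
        rw [if_neg (by tauto), h0]
        refine ⟨?_, ?_, ?_⟩
        · simp only [letterSkew, letterCocycle, h2, if_false, ih1, List.length_cons]
          push_cast
          ring
        · intro n hn
          obtain rfl : n = 0 := by simp at hn; omega
          simp [letterSkew, letterAct_zero h2]
        · intro n
          rw [List.length_cons, Nat.add_sub_cancel_left, add_comm 1 n]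
          simp only [letterSkew, letterAct_succ h2, ih3]
    · have h2 : ξ.1.1 0 ≠ linv a := by
        have h3 := ih2 0 (by omega)
        intro h4
        cases w with
        | nil => simp at h3
        | cons b w =>
          rw [List.getElem?_cons_zero, h4, Option.some.injEq] at h3
          have h5 := (FreeGroup.isReduced_cons_cons.1 hw).1
          simp [h3, linv] at h5
      rw [if_neg (by tauto)]
      refine ⟨?_, ?_, ?_⟩
      · simp only [letterSkew, letterCocycle, h2, if_false, ih1, List.length_cons]
        push_cast
        ring
      · intro n hn
        rw [List.length_cons] at hn
        cases n with
        | zero => simp [letterSkew, letterAct_zero h2]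
        | succ n =>
          rw [List.getElem?_cons_succ, ih2 n (by omega)]
          simp only [letterSkew, letterAct_succ h2]
      · intro n
        rw [List.length_cons, show w.length + 1 - cancelLen w ω.1 + n =
          w.length - cancelLen w ω.1 + n + 1 by omega]
        simp only [letterSkew, letterAct_succ h2, ih3]

theorem actSeq_add {m : ℕ} (g : FreeGroup (Fin m)) (ω : Boundary m) (n : ℕ) :
    actSeq g ω (g.toWord.length - cancelLen g.toWord ω.1 + n) =
      ω.1 (cancelLen g.toWord ω.1 + n) := by
  rw [actSeq, dif_neg (by omega), Nat.add_sub_cancel_left, add_comm]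

theorem gromov_bact {m : ℕ} (g : FreeGroup (Fin m)) (ω : Boundary m) :
    gromov g (bact g ω) = g.toWord.length - cancelLen g.toWord ω.1 := by
  obtain ⟨hle, hspec⟩ := cancelLen_spec g.toWord ω.1
  refine IsGreatest.csSup_eq ⟨fun i hi => ?_, fun k hk => ?_⟩
  · change _ = some (actSeq g ω i)
    rw [actSeq, dif_pos hi, List.getElem?_eq_getElem]
  · by_contra! hlt
    have h1 := hk _ hlt
    change _ = some (actSeq g ω _) at h1
    have h2 := actSeq_add g ω 0
    rw [add_zero, add_zero] at h2
    rw [h2] at h1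
    rcases Nat.eq_zero_or_pos (cancelLen g.toWord ω.1) with h0 | h0
    · rw [h0, Nat.sub_zero, List.getElem?_eq_none le_rfl] at h1
      simp at h1
    · have h3 := hspec (cancelLen g.toWord ω.1 - 1) (by omega)
      rw [show g.toWord.length - 1 - (cancelLen g.toWord ω.1 - 1) =
        g.toWord.length - cancelLen g.toWord ω.1 by omega, h1, Option.some.injEq] at h3
      refine ω.2 (cancelLen g.toWord ω.1 - 1) ?_
      rwa [Nat.sub_add_cancel h0]

theorem skewPerm_apply {m : ℕ} (g : FreeGroup (Fin m)) (ω : Boundary m) (k : ℤ) :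
    skewPerm m g (ω, k) = (bact g ω, k + busemann g (bact g ω)) := by
  obtain ⟨h1, h2, h3⟩ := foldr_letterSkew g.toWord FreeGroup.isReduced_toWord ω k
  obtain ⟨hle, -⟩ := cancelLen_spec g.toWord ω.1
  rw [← skewPerm_mk, FreeGroup.mk_toWord] at h1
  simp only [← skewPerm_mk, FreeGroup.mk_toWord] at h2 h3
  refine Prod.ext (Subtype.ext (funext fun n => ?_)) ?_
  · change _ = actSeq g ω n
    rcases Nat.lt_or_ge n (g.toWord.length - cancelLen g.toWord ω.1) with hn | hn
    · have h4 := h2 n hn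
      rw [List.getElem?_eq_getElem (by omega), Option.some.injEq] at h4
      rw [actSeq, dif_pos hn, h4]
    · obtain ⟨j, rfl⟩ := Nat.exists_eq_add_of_le hn
      rw [actSeq_add, h3]
  · rw [h1]
    simp only [busemann, gromov_bact, wlen]
    rw [Nat.cast_sub hle]
    ring

theorem bact_one {m : ℕ} (ω : Boundary m) : bact 1 ω = ω := by
  have h := skewPerm_apply 1 ω 0
  rw [map_one, Equiv.Perm.one_apply] at h
  exact (congrArg Prod.fst h).symm

theorem skewPerm_mul_apply {m : ℕ} (g h : FreeGroup (Fin m)) (ω : Boundary m) :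
    (bact (g * h) ω, busemann (g * h) (bact (g * h) ω)) =
      (bact g (bact h ω),
        busemann h (bact h ω) + busemann g (bact g (bact h ω))) := by
  have e := skewPerm_apply (g * h) ω 0
  rw [map_mul, Equiv.Perm.mul_apply, skewPerm_apply, skewPerm_apply] at e
  simpa using e.symm

theorem bact_mul {m : ℕ} (g h : FreeGroup (Fin m)) (ω : Boundary m) :
    bact (g * h) ω = bact g (bact h ω) :=
  congrArg Prod.fst (skewPerm_mul_apply g h ω)

/-- The Busemann cocycle identity. -/
theorem busemann_bact_mul {m : ℕ} (g h : FreeGroup (Fin m)) (ω : Boundary m) :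
    busemann (g * h) (bact (g * h) ω) =
      busemann g (bact g (bact h ω)) + busemann h (bact h ω) :=
  (congrArg Prod.snd (skewPerm_mul_apply g h ω)).trans (add_comm _ _)

theorem bact_letter {m : ℕ} (a : Letter m) (ω : Boundary m) :
    bact (FreeGroup.mk [a]) ω = letterAct a ω :=
  (congrArg Prod.fst ((skewPerm_apply (FreeGroup.mk [a]) ω 0).symm.trans (skewPerm_mk [a] _)))

theorem busemann_letter {m : ℕ} (a : Letter m) (ω : Boundary m) :
    busemann (FreeGroup.mk [a]) (bact (FreeGroup.mk [a]) ω) = letterCocycle a ω := by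
  have h := congrArg Prod.snd
    ((skewPerm_apply (FreeGroup.mk [a]) ω 0).symm.trans (skewPerm_mk [a] _))
  simpa [letterSkew] using h

/-- Induction on the free group as a monoid generated by letters. -/
theorem letter_induction {m : ℕ} {P : FreeGroup (Fin m) → Prop} (one : P 1)
    (letter : ∀ a : Letter m, P (FreeGroup.mk [a]))
    (mul : ∀ g h, P g → P h → P (g * h)) (g : FreeGroup (Fin m)) : P g :=
  FreeGroup.induction_on g one (fun i => letter (i, true)) (fun i _ => letter (i, false)) mul

theorem measurable_coord {m : ℕ} (n : ℕ) : Measurable fun ω : Boundary m => ω.1 n :=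
  (measurable_pi_apply n).comp measurable_subtype_coe

theorem measurableSet_coord_eq {m : ℕ} (n : ℕ) (a : Letter m) :
    MeasurableSet {ω : Boundary m | ω.1 n = a} :=
  measurable_coord n (measurableSet_singleton a)

theorem measurable_shift {m : ℕ} : Measurable (shift : Boundary m → Boundary m) :=
  (measurable_pi_lambda _ fun n => measurable_coord (n + 1)).subtype_mk

theorem measurable_letterAct {m : ℕ} (a : Letter m) : Measurable (letterAct a) := by
  refine (measurable_pi_lambda _ fun n => ?_).subtype_mk
  refine Measurable.ite (measurableSet_coord_eq 0 _) (measurable_coord _) ?_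
  split_ifs
  · exact measurable_const
  · exact measurable_coord _

theorem measurable_letterCocycle {m : ℕ} (a : Letter m) : Measurable (letterCocycle a) :=
  Measurable.ite (measurableSet_coord_eq 0 _) measurable_const measurable_const

theorem measurable_bact {m : ℕ} (g : FreeGroup (Fin m)) : Measurable (bact g) := by
  induction g using letter_induction with
  | one =>
    rw [show bact 1 = id from funext fun ω : Boundary m => bact_one ω]
    exact measurable_id
  | letter a =>
    rw [show bact (FreeGroup.mk [a]) = letterAct a from funext (bact_letter a)]
    exact measurable_letterAct a
  | mul g h hg hh =>
    rw [show bact (g * h) = bact g ∘ bact h from funext (bact_mul g h)]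
    exact hg.comp hh

theorem busemann_one {m : ℕ} (ω : Boundary m) : busemann 1 (bact 1 ω) = 0 := by
  have h := busemann_bact_mul 1 1 ω
  rw [mul_one, bact_one, bact_one] at h
  rw [bact_one]
  omega

theorem measurable_busemann_bact {m : ℕ} (g : FreeGroup (Fin m)) :
    Measurable fun ω => busemann g (bact g ω) := by
  induction g using letter_induction with
  | one => simp only [busemann_one, measurable_const]
  | letter a => simpa only [busemann_letter] using measurable_letterCocycle a
  | mul g h hg hh =>
    simp only [busemann_bact_mul]
    exact (hg.comp (measurable_bact h)).add hh

/-- Boundary points agreeing with the sequence `w` on the first `n` letters. -/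
def prefixSet {m : ℕ} (w : ℕ → Letter m) (n : ℕ) : Set (Boundary m) :=
  {ω | ∀ i < n, ω.1 i = w i}

theorem toWord_trunc {m : ℕ} (ω : Boundary m) (n : ℕ) :
    (trunc ω n).toWord = List.ofFn fun i : Fin n => ω.1 i := by
  rw [trunc, FreeGroup.toWord_mk]
  refine FreeGroup.IsReduced.reduce_eq (List.isChain_ofFn.2 fun i hi h1 => ?_)
  by_contra h2
  refine ω.2 i (Prod.ext h1.symm ?_)
  simp only [linv]
  revert h2
  cases (ω.1 i).2 <;> cases (ω.1 (i + 1)).2 <;> simp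

theorem cylinder_trunc {m : ℕ} (η : Boundary m) (n : ℕ) :
    cylinder (trunc η n) = prefixSet η.1 n := by
  have hlen : wlen (trunc η n) = n := by rw [wlen, toWord_trunc, List.length_ofFn]
  ext ω
  change trunc ω (wlen (trunc η n)) = trunc η n ↔ _
  rw [hlen, ← FreeGroup.toWord_inj, toWord_trunc, toWord_trunc, List.ofFn_inj, funext_iff]
  exact ⟨fun h i hi => h ⟨i, hi⟩, fun h i => h i i.2⟩

theorem isPiSystem_prefixSet (m : ℕ) :
    IsPiSystem {s : Set (Boundary m) | ∃ w n, s = prefixSet w (n + 1)} := by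
  rintro _ ⟨w, n, rfl⟩ _ ⟨v, k, rfl⟩ ⟨η, h1, h2⟩
  refine ⟨η.1, max n k, ?_⟩
  ext ω
  constructor
  · rintro ⟨h3, h4⟩ i hi
    rcases le_total n k with h | h
    · rw [max_eq_right h] at hi
      rw [h4 i hi, h2 i hi]
    · rw [max_eq_left h] at hi
      rw [h3 i hi, h1 i hi]
  · intro h
    exact ⟨fun i hi => (h i (by omega)).trans (h1 i hi),
      fun i hi => (h i (by omega)).trans (h2 i hi)⟩

theorem measurableSet_prefixSet {m : ℕ} (w : ℕ → Letter m) (n : ℕ) :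
    MeasurableSet (prefixSet w n) := by
  have : prefixSet w n = ⋂ i, ⋂ _ : i < n, {ω : Boundary m | ω.1 i = w i} := by
    ext ω
    simp [prefixSet]
  rw [this]
  exact MeasurableSet.iInter fun i => MeasurableSet.iInter fun _ => measurableSet_coord_eq i _

theorem generateFrom_prefixSet (m : ℕ) :
    (inferInstance : MeasurableSpace (Boundary m)) =
      MeasurableSpace.generateFrom {s | ∃ w n, s = prefixSet w (n + 1)} := by
  refine le_antisymm ?_ (MeasurableSpace.generateFrom_le ?_)
  · refine measurable_iff_comap_le.1 ?_
    refine @measurable_pi_lambda _ _ _ (_) _ _ fun i => ?_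
    refine @measurable_to_countable' _ _ _ _ (_) _ fun x => ?_
    have : (fun ω : Boundary m => ω.1 i) ⁻¹' {x} =
        ⋃ w : Fin (i + 1) → Letter m, ⋃ _ : w (Fin.last i) = x,
          prefixSet (fun j => w (Fin.ofNat (i + 1) j)) (i + 1) := by
      ext ω
      simp only [Set.mem_preimage, Set.mem_singleton_iff, Set.mem_iUnion, prefixSet]
      constructor
      · intro h
        refine ⟨fun j => ω.1 j, h, fun j hj => ?_⟩
        simp [Nat.mod_eq_of_lt hj]
      · rintro ⟨w, rfl, h⟩
        rw [h i (Nat.lt_succ_self i)]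
        congr 1
        ext
        simp
    rw [this]
    exact MeasurableSet.iUnion fun w => MeasurableSet.iUnion fun _ =>
      MeasurableSpace.measurableSet_generateFrom ⟨_, i, rfl⟩
  · rintro _ ⟨w, n, rfl⟩
    exact measurableSet_prefixSet w _

section UniformMeasure

variable {m : ℕ} {μ : Measure (Boundary m)}

theorem measure_prefixSet
    (hμ : ∀ g : FreeGroup (Fin m), g ≠ 1 →
      μ (cylinder g) = ((2 * m * (2 * m - 1) ^ (wlen g - 1) : ℕ) : ℝ≥0∞)⁻¹)
    (η : Boundary m) (n : ℕ) :
    μ (prefixSet η.1 (n + 1)) = ((2 * m * (2 * m - 1) ^ n : ℕ) : ℝ≥0∞)⁻¹ := by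
  have hlen : wlen (trunc η (n + 1)) = n + 1 := by rw [wlen, toWord_trunc, List.length_ofFn]
  rw [← cylinder_trunc, hμ _ ?_, hlen, Nat.add_sub_cancel]
  intro h
  rw [h] at hlen
  simp [wlen] at hlen

theorem measure_first_letter
    (hμ : ∀ g : FreeGroup (Fin m), g ≠ 1 →
      μ (cylinder g) = ((2 * m * (2 * m - 1) ^ (wlen g - 1) : ℕ) : ℝ≥0∞)⁻¹)
    (a : Letter m) : μ {ω | ω.1 0 = a} = ((2 * m : ℕ) : ℝ≥0∞)⁻¹ := by
  have h := measure_prefixSet hμ ⟨fun _ => a, fun _ => (linv_ne a).symm⟩ 0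
  have e : prefixSet (m := m) (fun _ => a) (0 + 1) = {ω | ω.1 0 = a} := by
    ext ω
    simp [prefixSet]
  rw [e] at h
  rw [h, pow_zero, mul_one]

theorem map_shift_restrict [IsProbabilityMeasure μ] (hm : 2 ≤ m)
    (hμ : ∀ g : FreeGroup (Fin m), g ≠ 1 →
      μ (cylinder g) = ((2 * m * (2 * m - 1) ^ (wlen g - 1) : ℕ) : ℝ≥0∞)⁻¹)
    (a : Letter m) :
    (μ.restrict {ω | ω.1 0 = a}).map shift =
      ((2 * m - 1 : ℕ) : ℝ≥0∞)⁻¹ • μ.restrict {ω | ω.1 0 = linv a}ᶜ := by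
  have hq0 : ((2 * m - 1 : ℕ) : ℝ≥0∞) ≠ 0 := by
    rw [Nat.cast_ne_zero]
    omega
  have hqt : ((2 * m - 1 : ℕ) : ℝ≥0∞) ≠ ⊤ := ENNReal.natCast_ne_top _
  refine ext_of_generate_finite _ (generateFrom_prefixSet m) (isPiSystem_prefixSet m) ?_ ?_
  · rintro _ ⟨w, n, rfl⟩
    have hmeas := measurableSet_prefixSet w (n + 1)
    rw [Measure.map_apply measurable_shift hmeas,
      Measure.restrict_apply (measurable_shift hmeas), Measure.smul_apply,
      Measure.restrict_apply hmeas, smul_eq_mul]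
    by_cases hw : w 0 = linv a
    · have e1 : shift ⁻¹' prefixSet w (n + 1) ∩ {ω : Boundary m | ω.1 0 = a} = ∅ := by
        ext ω
        simp only [Set.mem_inter_iff, Set.mem_empty_iff_false, iff_false, not_and]
        intro h1 h2
        have h3 : ω.1 1 = w 0 := h1 0 (Nat.succ_pos n)
        refine ω.2 0 ?_
        rw [zero_add, h3, hw, show ω.1 0 = a from h2]
      have e2 : prefixSet w (n + 1) ∩ {ω : Boundary m | ω.1 0 = linv a}ᶜ = ∅ := by
        ext ω
        simp only [Set.mem_inter_iff, Set.mem_empty_iff_false, iff_false, not_and]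
        intro h1 h2
        exact h2 ((h1 0 (Nat.succ_pos n)).trans hw)
      rw [e1, e2, measure_empty, mul_zero]
    · rcases (prefixSet w (n + 1)).eq_empty_or_nonempty with he | ⟨η, hη⟩
      · simp [he]
      · have hη0 : η.1 0 ≠ linv a := by rwa [hη 0 (Nat.succ_pos n)]
        have e1 : shift ⁻¹' prefixSet w (n + 1) ∩ {ω : Boundary m | ω.1 0 = a} =
            prefixSet (letterAct a η).1 (n + 1 + 1) := by
          ext ω
          constructor
          · rintro ⟨h1, h2⟩ i hi
            cases i with
            | zero => rw [letterAct_zero hη0]; exact h2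
            | succ i =>
              rw [letterAct_succ hη0, hη i (by omega)]
              exact h1 i (by omega)
          · intro h
            refine ⟨fun i hi => ?_, ?_⟩
            · have := h (i + 1) (by omega)
              rw [letterAct_succ hη0, hη i hi] at this
              exact this
            · have := h 0 (by omega)
              rwa [letterAct_zero hη0] at this
        have e2 : prefixSet w (n + 1) ∩ {ω : Boundary m | ω.1 0 = linv a}ᶜ =
            prefixSet η.1 (n + 1) := by
          ext ω
          constructor
          · rintro ⟨h1, -⟩ i hi
            rw [h1 i hi, hη i hi]
          · intro h
            refine ⟨fun i hi => by rw [h i hi, hη i hi], fun h1 => hη0 ?_⟩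
            rw [← h 0 (Nat.succ_pos n)]
            exact h1
        rw [e1, e2, measure_prefixSet hμ, measure_prefixSet hμ, pow_succ, ← mul_assoc,
          Nat.cast_mul _ (2 * m - 1), ENNReal.mul_inv (Or.inr hqt) (Or.inr hq0), mul_comm]
  · rw [Measure.map_apply measurable_shift MeasurableSet.univ, Set.preimage_univ,
      Measure.restrict_apply_univ, Measure.smul_apply, Measure.restrict_apply_univ,
      prob_compl_eq_one_sub (measurableSet_coord_eq 0 _), measure_first_letter hμ,
      measure_first_letter hμ, smul_eq_mul]
    have h2m0 : ((2 * m : ℕ) : ℝ≥0∞) ≠ 0 := by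
      rw [Nat.cast_ne_zero]
      omega
    have h2mt : ((2 * m : ℕ) : ℝ≥0∞) ≠ ⊤ := ENNReal.natCast_ne_top _
    have e : 1 - ((2 * m : ℕ) : ℝ≥0∞)⁻¹ = ((2 * m - 1 : ℕ) : ℝ≥0∞) * ((2 * m : ℕ) : ℝ≥0∞)⁻¹ := by
      refine ENNReal.sub_eq_of_eq_add (ENNReal.inv_ne_top.2 h2m0) ?_
      rw [← ENNReal.mul_inv_cancel h2m0 h2mt]
      nth_rw 1 [show 2 * m = (2 * m - 1) + 1 by omega]
      rw [Nat.cast_add, add_mul, Nat.cast_one, one_mul]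
    rw [e, ← mul_assoc, ENNReal.inv_mul_cancel hq0 hqt, one_mul]

/-- The Radon–Nikodym derivative of a letter with respect to the uniform measure. -/
theorem lintegral_letterAct [IsProbabilityMeasure μ] (hm : 2 ≤ m)
    (hμ : ∀ g : FreeGroup (Fin m), g ≠ 1 →
      μ (cylinder g) = ((2 * m * (2 * m - 1) ^ (wlen g - 1) : ℕ) : ℝ≥0∞)⁻¹)
    (a : Letter m) {f : Boundary m → ℝ≥0∞} (hf : Measurable f) :
    ∫⁻ ω, f (letterAct a ω) * ((2 * m - 1 : ℕ) : ℝ≥0∞) ^ letterCocycle a ω ∂μ =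
      ∫⁻ ω, f ω ∂μ := by
  have hq0 : ((2 * m - 1 : ℕ) : ℝ≥0∞) ≠ 0 := by
    rw [Nat.cast_ne_zero]
    omega
  have hqt : ((2 * m - 1 : ℕ) : ℝ≥0∞) ≠ ⊤ := ENNReal.natCast_ne_top _
  have hs := measurableSet_coord_eq (m := m) 0 (linv a)
  have hcancel : ∫⁻ ω in {ω | ω.1 0 = linv a},
      f (letterAct a ω) * ((2 * m - 1 : ℕ) : ℝ≥0∞) ^ letterCocycle a ω ∂μ =
      ∫⁻ ω in {ω | ω.1 0 = a}ᶜ, f ω ∂μ := by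
    calc _ = ∫⁻ ω in {ω | ω.1 0 = linv a}, f (shift ω) * ((2 * m - 1 : ℕ) : ℝ≥0∞) ∂μ := by
          refine setLIntegral_congr_fun hs fun ω hω => ?_
          have hω' : ω.1 0 = linv a := hω
          simp only [letterAct_of_eq hω', letterCocycle, hω', if_true, zpow_one]
      _ = (∫⁻ ω, f ω ∂((μ.restrict {ω | ω.1 0 = linv a}).map shift)) *
            ((2 * m - 1 : ℕ) : ℝ≥0∞) := by
          rw [lintegral_map hf measurable_shift,
            lintegral_mul_const _ (show Measurable fun ω => f (shift ω) from hf.comp measurable_shift)]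
      _ = _ := by
          rw [map_shift_restrict hm hμ, linv_linv, lintegral_smul_measure, smul_eq_mul, mul_comm,
            ← mul_assoc, ENNReal.mul_inv_cancel hq0 hqt, one_mul]
  have hcons : ∫⁻ ω in {ω | ω.1 0 = linv a}ᶜ,
      f (letterAct a ω) * ((2 * m - 1 : ℕ) : ℝ≥0∞) ^ letterCocycle a ω ∂μ =
      ∫⁻ ω in {ω | ω.1 0 = a}, f ω ∂μ := by
    have hfa : Measurable fun ω => f (letterAct a ω) := hf.comp (measurable_letterAct a)
    calc _ = ∫⁻ ω in {ω | ω.1 0 = linv a}ᶜ,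
            f (letterAct a ω) * ((2 * m - 1 : ℕ) : ℝ≥0∞)⁻¹ ∂μ := by
          refine setLIntegral_congr_fun hs.compl fun ω hω => ?_
          have hω' : ω.1 0 ≠ linv a := hω
          simp only [letterCocycle, hω', if_false]
          rw [zpow_neg_one]
      _ = ∫⁻ ω, f (letterAct a ω) ∂((μ.restrict {ω | ω.1 0 = a}).map shift) := by
          rw [map_shift_restrict hm hμ, lintegral_smul_measure, lintegral_mul_const _ hfa,
            smul_eq_mul, mul_comm]
      _ = _ := by
          rw [lintegral_map hfa measurable_shift]
          refine setLIntegral_congr_fun (measurableSet_coord_eq 0 a) fun ω hω => ?_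
          simp only [letterAct_shift (show ω.1 0 = a from hω)]
  rw [← lintegral_add_compl _ hs, hcancel, hcons, add_comm,
    lintegral_add_compl _ (measurableSet_coord_eq 0 a)]

/-- The Radon–Nikodym cocycle of the uniform measure is an exponential of the Busemann
cocycle. -/
theorem lintegral_bact [IsProbabilityMeasure μ] (hm : 2 ≤ m)
    (hμ : ∀ g : FreeGroup (Fin m), g ≠ 1 →
      μ (cylinder g) = ((2 * m * (2 * m - 1) ^ (wlen g - 1) : ℕ) : ℝ≥0∞)⁻¹)
    (g : FreeGroup (Fin m)) : ∀ {f : Boundary m → ℝ≥0∞}, Measurable f →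
    ∫⁻ ω, f (bact g ω) * ((2 * m - 1 : ℕ) : ℝ≥0∞) ^ busemann g (bact g ω) ∂μ =
      ∫⁻ ω, f ω ∂μ := by
  have hq0 : ((2 * m - 1 : ℕ) : ℝ≥0∞) ≠ 0 := by
    rw [Nat.cast_ne_zero]
    omega
  have hqt : ((2 * m - 1 : ℕ) : ℝ≥0∞) ≠ ⊤ := ENNReal.natCast_ne_top _
  induction g using letter_induction with
  | one =>
    intro f _
    simp only [busemann_one, zpow_zero, mul_one]
    simp only [bact_one]
  | letter a =>
    intro f hf
    simp only [busemann_letter]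
    simp only [bact_letter]
    exact lintegral_letterAct hm hμ a hf
  | mul g h hg hh =>
    intro f hf
    have hF : Measurable fun ω =>
        f (bact g ω) * ((2 * m - 1 : ℕ) : ℝ≥0∞) ^ busemann g (bact g ω) :=
      (hf.comp (measurable_bact g)).mul
        ((measurable_of_countable fun z : ℤ => ((2 * m - 1 : ℕ) : ℝ≥0∞) ^ z).comp
          (measurable_busemann_bact g))
    rw [← hg hf, ← hh hF]
    refine lintegral_congr fun ω => ?_
    rw [busemann_bact_mul, bact_mul, ENNReal.zpow_add hq0 hqt, mul_assoc]

theorem measure_image_bact [IsProbabilityMeasure μ] (hm : 2 ≤ m)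
    (hμ : ∀ g : FreeGroup (Fin m), g ≠ 1 →
      μ (cylinder g) = ((2 * m * (2 * m - 1) ^ (wlen g - 1) : ℕ) : ℝ≥0∞)⁻¹)
    (g : FreeGroup (Fin m)) {A : Set (Boundary m)} (hA : MeasurableSet A) :
    μ (bact g '' A) =
      ∫⁻ ω in A, ((2 * m - 1 : ℕ) : ℝ≥0∞) ^ busemann g (bact g ω) ∂μ := by
  have hinv : ∀ (g : FreeGroup (Fin m)) ω, bact g⁻¹ (bact g ω) = ω := fun g ω => by
    rw [← bact_mul, inv_mul_cancel, bact_one]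
  have himg : bact g '' A = bact g⁻¹ ⁻¹' A := by
    ext ω
    constructor
    · rintro ⟨η, hη, rfl⟩
      rwa [Set.mem_preimage, hinv]
    · intro h
      refine ⟨_, h, ?_⟩
      have := hinv g⁻¹ ω
      rwa [inv_inv] at this
  have hgA : MeasurableSet (bact g '' A) := himg ▸ measurable_bact g⁻¹ hA
  rw [← lintegral_indicator_one hgA, ← lintegral_bact hm hμ g (measurable_one.indicator hgA),
    ← lintegral_indicator hA]
  refine lintegral_congr fun ω => ?_
  have hmem : bact g ω ∈ bact g '' A ↔ ω ∈ A := by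
    rw [himg, Set.mem_preimage, hinv]
  by_cases h : ω ∈ A
  · simp [Set.indicator_of_mem h, Set.indicator_of_mem (hmem.2 h)]
  · simp [Set.indicator_of_notMem h, Set.indicator_of_notMem (mt hmem.1 h)]

theorem isExpandingCocycle_busemann [IsProbabilityMeasure μ] (hm : 2 ≤ m)
    (hμ : ∀ g : FreeGroup (Fin m), g ≠ 1 →
      μ (cylinder g) = ((2 * m * (2 * m - 1) ^ (wlen g - 1) : ℕ) : ℝ≥0∞)⁻¹)
    (H : Subgroup (FreeGroup (Fin m))) :
    IsExpandingCocycle μ (fun h : H => bact (h : FreeGroup (Fin m)))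
      (fun h ω => busemann (h : FreeGroup (Fin m)) (bact (h : FreeGroup (Fin m)) ω)) where
  one_act := bact_one
  mul_act g h := bact_mul _ _
  cocycle g h := busemann_bact_mul _ _
  measurable_act g := measurable_bact _
  measurable_cocycle g := measurable_busemann_bact _
  null_image g A hA h0 := by
    rw [measure_image_bact hm hμ _ hA, setLIntegral_measure_zero _ _ h0]
  two_mul_le g A hA hpos := by
    rw [measure_image_bact hm hμ _ hA, ← setLIntegral_const]
    refine setLIntegral_mono' hA fun ω hω => ?_
    obtain ⟨n, hn⟩ := Int.eq_ofNat_of_zero_le (hpos ω hω).le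
    have hn0 : n ≠ 0 := by
      have := hpos ω hω
      omega
    rw [hn, zpow_natCast]
    have h2 : (2 : ℝ≥0∞) ≤ ((2 * m - 1 : ℕ) : ℝ≥0∞) := by
      exact_mod_cast (by omega : 2 ≤ 2 * m - 1)
    exact h2.trans (le_self_pow (one_le_two.trans h2) hn0)

end UniformMeasure

/-- **The horocycle flow has the same ergodic properties as the boundary action.** The
skew action of `H` on `∂F × ℤ` (the action on horospheres) determined by the Busemann
cocycle is conservative iff the boundary action is, and completely dissipative iff the
boundary action is. -/
theorem horosphere_action_conservative_dissipative_iff (m : ℕ) (hm : 2 ≤ m)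
    (μ : Measure (Boundary m)) [IsProbabilityMeasure μ]
    (hμ : ∀ g : FreeGroup (Fin m), g ≠ 1 →
      μ (cylinder g) = ((2 * m * (2 * m - 1) ^ (wlen g - 1) : ℕ) : ℝ≥0∞)⁻¹)
    (H : Subgroup (FreeGroup (Fin m)))
    (μt : Measure (Boundary m × ℤ)) (hμt : μt = μ.prod Measure.count)
    (actZ : FreeGroup (Fin m) → Boundary m × ℤ → Boundary m × ℤ)
    (hactZ : ∀ (g : FreeGroup (Fin m)) (p : Boundary m × ℤ),
      actZ g p = (bact g p.1, p.2 + busemann g (bact g p.1))) :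
    ((∀ W : Set (Boundary m × ℤ), MeasurableSet W →
        (∀ h h' : H, h ≠ h' →
          μt (actZ (h : FreeGroup (Fin m)) '' W ∩ actZ (h' : FreeGroup (Fin m)) '' W) = 0) →
        μt W = 0) ↔
      (∀ W : Set (Boundary m), MeasurableSet W →
        (∀ h h' : H, h ≠ h' →
          μ (bact (h : FreeGroup (Fin m)) '' W ∩ bact (h' : FreeGroup (Fin m)) '' W) = 0) →
        μ W = 0)) ∧
    ((∃ W : Set (Boundary m × ℤ), MeasurableSet W ∧
        (∀ h h' : H, h ≠ h' →
          μt (actZ (h : FreeGroup (Fin m)) '' W ∩ actZ (h' : FreeGroup (Fin m)) '' W) = 0) ∧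
        μt (Set.univ \ ⋃ h : H, actZ (h : FreeGroup (Fin m)) '' W) = 0) ↔
      (∃ W : Set (Boundary m), MeasurableSet W ∧
        (∀ h h' : H, h ≠ h' →
          μ (bact (h : FreeGroup (Fin m)) '' W ∩ bact (h' : FreeGroup (Fin m)) '' W) = 0) ∧
        μ (Set.univ \ ⋃ h : H, bact (h : FreeGroup (Fin m)) '' W) = 0)) := by
  subst hμt
  have hT := isExpandingCocycle_busemann hm hμ H
  have hS : ∀ (h : H) (p : Boundary m × ℤ), actZ h p =
      (bact (h : FreeGroup (Fin m)) p.1,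
        p.2 + busemann (h : FreeGroup (Fin m)) (bact (h : FreeGroup (Fin m)) p.1)) :=
    fun h p => hactZ h p
  exact ⟨hT.conservative_skew_iff (S := fun h : H => actZ h) hS,
    hT.dissipative_skew_iff (S := fun h : H => actZ h) hS⟩
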